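/- Let ν > 0, let m ≥ 1 be an integer, and let f : ℂ → ℂ be an entire function such that ∫_ℂ |f^{(m)}(z)|² e^{−ν|z|²} dλ(z) < ∞, where f^{(m)} is the m-th complex derivative of f. Then ∫_ℂ |f(z)|² e^{−ν|z|²} dλ(z) < ∞. -/

import Mathlib

open MeasureTheory

lemma aux_interval (ν : ℝ) (hν : 0 < ν) (F F' : ℝ → ℂ) (hF : ∀ r, HasDerivAt F (F' r) r)
    (hF' : Continuous F') (R : ℝ) (hR : 1 ≤ R) :
    ∫ r in (1:ℝ)..R, r * (‖F r‖ ^ 2 * Real.exp (-ν * r ^ 2)) ≤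
      ‖F 1‖ ^ 2 / ν + (1 / ν ^ 2) * ∫ r in (1:ℝ)..R, r * (‖F' r‖ ^ 2 * Real.exp (-ν * r ^ 2)) := by
  have hFc : Continuous F := continuous_iff_continuousAt.2 fun r => (hF r).continuousAt
  have hd : ∀ r, HasDerivAt (fun r => ‖F r‖ ^ 2 * Real.exp (-ν * r ^ 2))
      ((2 * inner ℝ (F r) (F' r)) * Real.exp (-ν * r ^ 2)
        + ‖F r‖ ^ 2 * (Real.exp (-ν * r ^ 2) * (-ν * (2 * r)))) r := by
    intro r
    have h1 := (hF r).norm_sq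
    have h2 : HasDerivAt (fun r : ℝ => -ν * r ^ 2) (-ν * (2 * r)) r := by
      simpa using (hasDerivAt_pow 2 r).const_mul (-ν)
    exact h1.mul h2.exp
  have hint := intervalIntegral.integral_eq_sub_of_hasDerivAt (a := 1) (b := R)
    (fun r _ => hd r) (Continuous.intervalIntegrable (by fun_prop) _ _)
  have hmono := intervalIntegral.integral_mono_on (μ := volume) hR
    (f := fun r => (2 * inner ℝ (F r) (F' r)) * Real.exp (-ν * r ^ 2)
        + ‖F r‖ ^ 2 * (Real.exp (-ν * r ^ 2) * (-ν * (2 * r))))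
    (g := fun r => (1 / ν) * (r * (‖F' r‖ ^ 2 * Real.exp (-ν * r ^ 2)))
        - ν * (r * (‖F r‖ ^ 2 * Real.exp (-ν * r ^ 2))))
    (Continuous.intervalIntegrable (by fun_prop) _ _)
    (Continuous.intervalIntegrable (by fun_prop) _ _)
    (by
      intro r hr
      have hr1 : 1 ≤ r := hr.1
      have hi : inner ℝ (F r) (F' r) ≤ ‖F r‖ * ‖F' r‖ := real_inner_le_norm _ _
      have hy : 2 * (‖F r‖ * ‖F' r‖) ≤ ν * ‖F r‖ ^ 2 + (1 / ν) * ‖F' r‖ ^ 2 := by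
        have : ν * ‖F r‖ ^ 2 + (1 / ν) * ‖F' r‖ ^ 2 - 2 * (‖F r‖ * ‖F' r‖)
            = (1 / ν) * (ν * ‖F r‖ - ‖F' r‖) ^ 2 := by field_simp; ring
        have h0 : 0 ≤ (1 / ν) * (ν * ‖F r‖ - ‖F' r‖) ^ 2 := by positivity
        linarith
      have hk : ν * ‖F r‖ ^ 2 + (1 / ν) * ‖F' r‖ ^ 2
          ≤ r * (ν * ‖F r‖ ^ 2 + (1 / ν) * ‖F' r‖ ^ 2) :=
        le_mul_of_one_le_left (by positivity) hr1
      have he := Real.exp_pos (-ν * r ^ 2)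
      have := mul_le_mul_of_nonneg_right
        (show 2 * inner ℝ (F r) (F' r) ≤ r * (ν * ‖F r‖ ^ 2 + (1 / ν) * ‖F' r‖ ^ 2) by linarith)
        he.le
      linarith)
  rw [hint, intervalIntegral.integral_sub (Continuous.intervalIntegrable (by fun_prop) _ _)
    (Continuous.intervalIntegrable (by fun_prop) _ _), intervalIntegral.integral_const_mul,
    intervalIntegral.integral_const_mul] at hmono
  set A := ∫ r in (1:ℝ)..R, r * (‖F r‖ ^ 2 * Real.exp (-ν * r ^ 2))
  set B := ∫ r in (1:ℝ)..R, r * (‖F' r‖ ^ 2 * Real.exp (-ν * r ^ 2))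
  have h1 : ‖F 1‖ ^ 2 * Real.exp (-ν * 1 ^ 2) ≤ ‖F 1‖ ^ 2 :=
    mul_le_of_le_one_right (by positivity) (by rw [Real.exp_le_one_iff]; linarith)
  have h2 : 0 ≤ ‖F R‖ ^ 2 * Real.exp (-ν * R ^ 2) := by positivity
  have h3 : ν * A ≤ ‖F 1‖ ^ 2 + 1 / ν * B := by
    clear_value A B
    generalize ‖F 1‖ ^ 2 * Real.exp (-ν * 1 ^ 2) = X at *
    generalize ‖F R‖ ^ 2 * Real.exp (-ν * R ^ 2) = Y at *
    generalize ‖F 1‖ ^ 2 = Z at *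
    generalize 1 / ν * B = W at *
    generalize ν * A = V at *
    linarith only [hmono, h1, h2]
  have h4 : ‖F 1‖ ^ 2 / ν + 1 / ν ^ 2 * B = (‖F 1‖ ^ 2 + 1 / ν * B) / ν := by field_simp
  rw [h4, le_div_iff₀ hν]; linarith

lemma aux_ray (ν : ℝ) (hν : 0 < ν) (F F' : ℝ → ℂ) (hF : ∀ r, HasDerivAt F (F' r) r)
    (hF' : Continuous F') :
    ∫⁻ r in Set.Ioi (1:ℝ), ENNReal.ofReal (r * (‖F r‖ ^ 2 * Real.exp (-ν * r ^ 2))) ≤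
      ENNReal.ofReal (‖F 1‖ ^ 2 / ν) + ENNReal.ofReal (1 / ν ^ 2) *
        ∫⁻ r in Set.Ioi (1:ℝ), ENNReal.ofReal (r * (‖F' r‖ ^ 2 * Real.exp (-ν * r ^ 2))) := by
  have hFc : Continuous F := continuous_iff_continuousAt.2 fun r => (hF r).continuousAt
  have key : ∀ (G : ℝ → ℂ), Continuous G → ∀ R : ℝ, 1 ≤ R →
      ENNReal.ofReal (∫ r in (1:ℝ)..R, r * (‖G r‖ ^ 2 * Real.exp (-ν * r ^ 2))) =
      ∫⁻ r in Set.Ioc 1 R, ENNReal.ofReal (r * (‖G r‖ ^ 2 * Real.exp (-ν * r ^ 2))) := by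
    intro G hG R hR
    rw [intervalIntegral.integral_of_le hR]
    apply ofReal_integral_eq_lintegral_ofReal
    · have : Continuous fun r => r * (‖G r‖ ^ 2 * Real.exp (-ν * r ^ 2)) := by fun_prop
      exact (this.intervalIntegrable 1 R).1
    · filter_upwards [ae_restrict_mem measurableSet_Ioc] with r hr
      have : 0 ≤ r := by linarith [hr.1]
      simp only [Pi.zero_apply]
      positivity
  have hcov : AECover (volume.restrict (Set.Ioi (1:ℝ))) Filter.atTop (fun R : ℝ => Set.Iic R) :=
    aecover_Iic Filter.tendsto_id
  have ht := hcov.lintegral_tendsto_of_countably_generated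
    (f := fun r => ENNReal.ofReal (r * (‖F r‖ ^ 2 * Real.exp (-ν * r ^ 2))))
    (ENNReal.continuous_ofReal.comp (by fun_prop)).aemeasurable
  refine le_of_tendsto ht ?_
  filter_upwards [Filter.eventually_ge_atTop 1] with R hR
  have hs : Set.Iic R ∩ Set.Ioi 1 = Set.Ioc 1 R := by
    ext x; simp [and_comm]
  rw [Measure.restrict_restrict measurableSet_Iic, hs, ← key F hFc R hR]
  refine (ENNReal.ofReal_le_ofReal (aux_interval ν hν F F' hF hF' R hR)).trans ?_
  refine ENNReal.ofReal_add_le.trans ?_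
  rw [ENNReal.ofReal_mul (by positivity), key F' hF' R hR]
  gcongr
  exact Set.Ioc_subset_Ioi_self

lemma aux_key (ν : ℝ) (hν : 0 < ν) (f : ℂ → ℂ) (hf : Differentiable ℂ f)
    (h : Integrable (fun z : ℂ => ‖deriv f z‖ ^ 2 * Real.exp (-ν * ‖z‖ ^ 2))) :
    Integrable (fun z : ℂ => ‖f z‖ ^ 2 * Real.exp (-ν * ‖z‖ ^ 2)) := by
  have hfc := hf.continuous
  have hdc : Continuous (deriv f) := (hf.contDiff (n := 1)).continuous_deriv le_rfl
  have hc : Continuous (fun z : ℂ => ‖f z‖ ^ 2 * Real.exp (-ν * ‖z‖ ^ 2)) := by fun_prop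
  rw [← integrableOn_univ, ← Set.union_compl_self (Metric.closedBall (0:ℂ) 1), integrableOn_union]
  refine ⟨hc.continuousOn.integrableOn_compact (isCompact_closedBall _ _), ?_⟩
  have hms : MeasurableSet (Metric.closedBall (0:ℂ) 1)ᶜ := measurableSet_closedBall.compl
  have hpol : ∀ g : ℂ → ℂ, Continuous g →
      ∫⁻ z in (Metric.closedBall (0:ℂ) 1)ᶜ,
        ENNReal.ofReal (‖g z‖ ^ 2 * Real.exp (-ν * ‖z‖ ^ 2)) =
      ∫⁻ θ in Set.Ioo (-Real.pi) Real.pi, ∫⁻ r in Set.Ioi (1:ℝ),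
        ENNReal.ofReal (r * (‖g (r * Complex.exp (θ * Complex.I))‖ ^ 2
          * Real.exp (-ν * r ^ 2))) := by
    intro g hg
    rw [← lintegral_indicator hms, ← Complex.lintegral_comp_polarCoord_symm]
    have hm : Measurable (fun p : ℝ × ℝ => (Set.Ioi (1:ℝ)).indicator (fun r =>
        ENNReal.ofReal (r * (‖g (r * Complex.exp (p.2 * Complex.I))‖ ^ 2
          * Real.exp (-ν * r ^ 2)))) p.1) := by
      have : Measurable (fun p : ℝ × ℝ => 
        ENNReal.ofReal (p.1 * (‖g (p.1 * Complex.exp (p.2 * Complex.I))‖ ^ 2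
          * Real.exp (-ν * p.1 ^ 2)))) := (ENNReal.continuous_ofReal.comp (by fun_prop)).measurable
      exact this.indicator (s := Prod.fst ⁻¹' Set.Ioi (1:ℝ)) (measurable_fst measurableSet_Ioi)
    have e1 : ∫⁻ p in polarCoord.target, ENNReal.ofReal p.1 •
        (Metric.closedBall (0:ℂ) 1)ᶜ.indicator
          (fun z => ENNReal.ofReal (‖g z‖ ^ 2 * Real.exp (-ν * ‖z‖ ^ 2)))
          (Complex.polarCoord.symm p) =
        ∫⁻ p in polarCoord.target, (Set.Ioi (1:ℝ)).indicator (fun r =>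
        ENNReal.ofReal (r * (‖g (r * Complex.exp (p.2 * Complex.I))‖ ^ 2
          * Real.exp (-ν * r ^ 2)))) p.1 := by
      apply setLIntegral_congr_fun polarCoord.open_target.measurableSet
      rintro ⟨r, θ⟩ hp
      have hr : 0 < r := by
        have := hp.1
        simpa using this
      have hz : Complex.polarCoord.symm (r, θ) = r * Complex.exp (θ * Complex.I) := by
        rw [Complex.polarCoord_symm_apply, Complex.exp_mul_I]; simp
      have hn : ‖(r : ℂ) * Complex.exp (θ * Complex.I)‖ = r := by
        rw [norm_mul, Complex.norm_exp_ofReal_mul_I]; simp [abs_of_pos hr]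
      simp only [hz]
      by_cases h1 : 1 < r
      · rw [Set.indicator_of_mem (by simpa [abs_of_pos hr] using h1), Set.indicator_of_mem (by simpa using h1),
          hn, smul_eq_mul, ← ENNReal.ofReal_mul hr.le]
      · rw [Set.indicator_of_notMem (by simpa [abs_of_pos hr] using h1),
          Set.indicator_of_notMem (by simpa using h1)]
        simp
    rw [e1, polarCoord_target, Measure.volume_eq_prod, ← Measure.prod_restrict,
      lintegral_prod_symm _ hm.aemeasurable]
    refine lintegral_congr fun θ => ?_
    simp only
    rw [lintegral_indicator measurableSet_Ioi, Measure.restrict_restrict measurableSet_Ioi]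
    congr 2
    ext x
    simp only [Set.mem_inter_iff, Set.mem_Ioi]
    constructor
    · exact fun h => h.1
    · exact fun h => ⟨h, by linarith⟩
  have hfin : ∫⁻ z in (Metric.closedBall (0:ℂ) 1)ᶜ,
        ENNReal.ofReal (‖deriv f z‖ ^ 2 * Real.exp (-ν * ‖z‖ ^ 2)) < ⊤ := by
    have := (h.restrict (s := (Metric.closedBall (0:ℂ) 1)ᶜ)).2
    rwa [hasFiniteIntegral_iff_ofReal (Filter.Eventually.of_forall fun z => by
      simp only [Pi.zero_apply]; positivity)] at this
  refine ⟨hc.aestronglyMeasurable, ?_⟩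
  rw [hasFiniteIntegral_iff_ofReal (Filter.Eventually.of_forall fun z => by
      simp only [Pi.zero_apply]; positivity), hpol f hfc]
  rw [hpol _ hdc] at hfin
  have hray : ∀ θ : ℝ, ∫⁻ r in Set.Ioi (1:ℝ),
        ENNReal.ofReal (r * (‖f (r * Complex.exp (θ * Complex.I))‖ ^ 2
          * Real.exp (-ν * r ^ 2))) ≤
      ENNReal.ofReal (‖f (Complex.exp (θ * Complex.I))‖ ^ 2 / ν) + ENNReal.ofReal (1 / ν ^ 2) *
      ∫⁻ r in Set.Ioi (1:ℝ),
        ENNReal.ofReal (r * (‖deriv f (r * Complex.exp (θ * Complex.I))‖ ^ 2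
          * Real.exp (-ν * r ^ 2))) := by
    intro θ
    have := aux_ray ν hν (fun r => f (r * Complex.exp (θ * Complex.I)))
      (fun r => deriv f (r * Complex.exp (θ * Complex.I)) * Complex.exp (θ * Complex.I))
      (by
        intro r
        have h1 : HasDerivAt (fun r : ℝ => (r : ℂ) * Complex.exp (θ * Complex.I))
            (Complex.exp (θ * Complex.I)) r := by
          simpa using (Complex.ofRealCLM.hasDerivAt (x := r)).mul_const
            (Complex.exp (θ * Complex.I))
        exact (hf _).hasDerivAt.comp r h1)
      (by fun_prop)
    simpa only [norm_mul, Complex.norm_exp_ofReal_mul_I, mul_one, Complex.ofReal_one, one_mul]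
      using this
  refine (lintegral_mono hray).trans_lt ?_
  have hcm : Continuous (fun θ : ℝ => ‖f (Complex.exp (θ * Complex.I))‖ ^ 2 / ν) := by fun_prop
  rw [lintegral_add_left hcm.measurable.ennreal_ofReal,
    lintegral_const_mul' _ _ ENNReal.ofReal_ne_top]
  refine ENNReal.add_lt_top.2 ⟨?_, ENNReal.mul_lt_top ENNReal.ofReal_lt_top hfin⟩
  have : IntegrableOn (fun θ : ℝ => ‖f (Complex.exp (θ * Complex.I))‖ ^ 2 / ν)
      (Set.Ioo (-Real.pi) Real.pi) :=
    (hcm.continuousOn.integrableOn_compact isCompact_Icc).mono_set Set.Ioo_subset_Icc_self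
  have := this.2
  rwa [hasFiniteIntegral_iff_ofReal (Filter.Eventually.of_forall fun z => by
      simp only [Pi.zero_apply]; positivity)] at this

theorem stmt19 (ν : ℝ) (hν : 0 < ν) (m : ℕ) (hm : 1 ≤ m) (f : ℂ → ℂ)
    (hf : Differentiable ℂ f)
    (h : Integrable (fun z : ℂ => ‖iteratedDeriv m f z‖ ^ 2 * Real.exp (-ν * ‖z‖ ^ 2))) :
    Integrable (fun z : ℂ => ‖f z‖ ^ 2 * Real.exp (-ν * ‖z‖ ^ 2)) := by
  clear hm
  induction m generalizing f with
  | zero => simpa using h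
  | succ n ih =>
    rw [iteratedDeriv_succ'] at h
    refine aux_key ν hν f hf (ih (deriv f) ?_ h)
    exact ((hf.contDiff (n := 2)).differentiable_deriv_two)
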